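/- arXiv:2212.12011 — 4 statements merged into one kernel-verified Lean document; each statement's English description precedes it below -/
import Mathlib

section
/- Let n be a positive natural number and let P be an n × n real matrix that is row-stochastic (all entries nonnegative and each row sums to 1) and regular (there exists a power k ≥ 1 such that every entry of P^k is strictly positive). Then there exists a probability vector w (nonnegative entries summing to 1) with all entries strictly positive such that the matrix powers P^m converge entrywise, as m → ∞, to the matrix W whose every row equals w. -/
namespace Matrix

variable {ι : Type*} [Fintype ι] [DecidableEq ι]

/-- A row-stochastic matrix averages the entries of a vector, so it preserves entrywise bounds. -/
lemma mulVec_mem_Icc_of_mem_rowStochastic {P : Matrix ι ι ℝ} (hP : P ∈ rowStochastic ℝ ι)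
    {x : ι → ℝ} {a b : ℝ} (hx : ∀ i, x i ∈ Set.Icc a b) (i : ι) :
    (P *ᵥ x) i ∈ Set.Icc a b :=
  (convex_Icc a b).sum_mem (fun _ _ => nonneg_of_mem_rowStochastic hP)
    (sum_row_of_mem_rowStochastic hP i) (fun j _ => hx j)

/-- A row-stochastic matrix with all entries at least `ε` shrinks the range of a vector by the
factor `1 - card ι * ε`. -/
lemma exists_mulVec_mem_Icc_of_le {Q : Matrix ι ι ℝ} (hQ : Q ∈ rowStochastic ℝ ι) {ε : ℝ}
    (hε : ∀ i j, ε ≤ Q i j) {x : ι → ℝ} {a b : ℝ} (hx : ∀ i, x i ∈ Set.Icc a b) :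
    ∃ a' b', b' - a' = (1 - Fintype.card ι * ε) * (b - a) ∧
      ∀ i, (Q *ᵥ x) i ∈ Set.Icc a' b' := by
  refine ⟨ε * ∑ l, x l + (1 - Fintype.card ι * ε) * a,
    ε * ∑ l, x l + (1 - Fintype.card ι * ε) * b, by ring, fun i => ?_⟩
  have hsplit : (Q *ᵥ x) i = ε * ∑ l, x l + ∑ l, (Q i l - ε) * x l := by
    simp only [mulVec, dotProduct, sub_mul, Finset.sum_sub_distrib, Finset.mul_sum]
    ring
  have hconst (c : ℝ) : (1 - Fintype.card ι * ε) * c = ∑ l, (Q i l - ε) * c := by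
    rw [← Finset.sum_mul, Finset.sum_sub_distrib, sum_row_of_mem_rowStochastic hQ]
    simp
  rw [hsplit, hconst, hconst]
  constructor <;> gcongr with l
  · exact sub_nonneg.2 (hε i l)
  · exact (hx l).1
  · exact sub_nonneg.2 (hε i l)
  · exact (hx l).2

lemma exists_pow_mulVec_mem_Icc_of_le {Q : Matrix ι ι ℝ} (hQ : Q ∈ rowStochastic ℝ ι) {ε : ℝ}
    (hε : ∀ i j, ε ≤ Q i j) {x : ι → ℝ} {a b : ℝ} (hx : ∀ i, x i ∈ Set.Icc a b) (t : ℕ) :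
    ∃ a' b', b' - a' = (1 - Fintype.card ι * ε) ^ t * (b - a) ∧
      ∀ i, (Q ^ t *ᵥ x) i ∈ Set.Icc a' b' := by
  induction t with
  | zero => exact ⟨a, b, by simp, by simpa using hx⟩
  | succ t ih =>
    obtain ⟨a₁, b₁, h₁, hx₁⟩ := ih
    obtain ⟨a₂, b₂, h₂, hx₂⟩ := exists_mulVec_mem_Icc_of_le hQ hε hx₁
    refine ⟨a₂, b₂, by rw [h₂, h₁]; ring, ?_⟩
    simpa [pow_succ', mulVec_mulVec] using hx₂

/-- If a vector has entries in `[a, b]` after `N` steps, this remains so at all later steps. -/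
lemma pow_mulVec_mem_Icc_of_le {P : Matrix ι ι ℝ} (hP : P ∈ rowStochastic ℝ ι)
    {x : ι → ℝ} {a b : ℝ} {N m : ℕ} (hNm : N ≤ m)
    (hx : ∀ i, (P ^ N *ᵥ x) i ∈ Set.Icc a b) (i : ι) : (P ^ m *ᵥ x) i ∈ Set.Icc a b := by
  obtain ⟨d, rfl⟩ := Nat.exists_eq_add_of_le' hNm
  rw [pow_add, ← mulVec_mulVec]
  exact mulVec_mem_Icc_of_mem_rowStochastic (pow_mem hP d) hx i

/-- The iterates of a regular row-stochastic matrix on a vector converge to a constant vector. -/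
lemma exists_tendsto_pow_mulVec [Nonempty ι] {P : Matrix ι ι ℝ} (hP : P ∈ rowStochastic ℝ ι)
    {k : ℕ} {ε : ℝ} (hε₀ : 0 < ε) (hε : ∀ i j, ε ≤ (P ^ k) i j)
    {x : ι → ℝ} {a b : ℝ} (hx : ∀ i, x i ∈ Set.Icc a b) :
    ∃ L, ∀ i, Filter.Tendsto (fun m => (P ^ m *ᵥ x) i) Filter.atTop (nhds L) := by
  obtain ⟨i₀⟩ := ‹Nonempty ι›
  have hQ := pow_mem hP k
  have hr₀ : 0 ≤ 1 - Fintype.card ι * ε := by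
    have := Finset.sum_le_sum fun j (_ : j ∈ Finset.univ) => hε i₀ j
    rw [sum_row_of_mem_rowStochastic hQ] at this
    simpa using this
  have hr₁ : 1 - Fintype.card ι * ε < 1 := by
    have : (0 : ℝ) < Fintype.card ι := by exact_mod_cast Fintype.card_pos_iff.2 ⟨i₀⟩
    nlinarith
  have hclose (δ : ℝ) (hδ : 0 < δ) :
      ∃ N, ∀ m ≥ N, ∀ m' ≥ N, ∀ i i', dist ((P ^ m *ᵥ x) i) ((P ^ m' *ᵥ x) i') < δ := by
    have hlim : Filter.Tendsto (fun t : ℕ => (1 - Fintype.card ι * ε) ^ t * (b - a))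
        Filter.atTop (nhds 0) := by
      simpa using (tendsto_pow_atTop_nhds_zero_of_lt_one hr₀ hr₁).mul_const (b - a)
    obtain ⟨t, ht⟩ := (hlim.eventually_lt_const hδ).exists
    obtain ⟨a', b', hab, hx'⟩ := exists_pow_mulVec_mem_Icc_of_le hQ hε hx t
    rw [← pow_mul] at hx'
    refine ⟨k * t, fun m hm m' hm' i i' => ?_⟩
    exact (Real.dist_le_of_mem_Icc (pow_mulVec_mem_Icc_of_le hP hm hx' i)
      (pow_mulVec_mem_Icc_of_le hP hm' hx' i')).trans_lt (hab ▸ ht)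
  have hcauchy : CauchySeq fun m => (P ^ m *ᵥ x) i₀ := by
    refine Metric.cauchySeq_iff.2 fun δ hδ => ?_
    obtain ⟨N, hN⟩ := hclose δ hδ
    exact ⟨N, fun m hm m' hm' => hN m hm m' hm' i₀ i₀⟩
  obtain ⟨L, hL⟩ := cauchySeq_tendsto_of_complete hcauchy
  refine ⟨L, fun i => hL.congr_dist (Metric.tendsto_atTop.2 fun δ hδ => ?_)⟩
  obtain ⟨N, hN⟩ := hclose δ hδ
  exact ⟨N, fun m hm => by simpa using hN m hm m hm i₀ i⟩

end Matrix

/-- For a row-stochastic regular matrix `P`, there is a strictly positive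
probability vector `w` such that the powers `P ^ m` converge entrywise to
the matrix `W` whose every row equals `w`. -/
theorem regular_stochastic_powers_tendsto
    (n : ℕ) (hn : 0 < n) (P : Matrix (Fin n) (Fin n) ℝ)
    (hnonneg : ∀ i j, 0 ≤ P i j) (hrow : ∀ i, ∑ j, P i j = 1)
    (hreg : ∃ k, 1 ≤ k ∧ ∀ i j, 0 < (P ^ k) i j) :
    ∃ w : Fin n → ℝ, (∀ j, 0 ≤ w j) ∧ (∑ j, w j = 1) ∧ (∀ j, 0 < w j) ∧
      ∀ i j, Filter.Tendsto (fun m => (P ^ m) i j) Filter.atTop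
        (nhds ((Matrix.of fun _ j' => w j' : Matrix (Fin n) (Fin n) ℝ) i j)) := by
  have hP : P ∈ Matrix.rowStochastic ℝ (Fin n) :=
    Matrix.mem_rowStochastic_iff_sum.2 ⟨hnonneg, hrow⟩
  obtain ⟨k, -, hk⟩ := hreg
  let i₀ : Fin n := ⟨0, hn⟩
  have : Nonempty (Fin n) := ⟨i₀⟩
  obtain ⟨p, hp⟩ := Finite.exists_min fun p : Fin n × Fin n => (P ^ k) p.1 p.2
  have hε (i j) : (P ^ k) p.1 p.2 ≤ (P ^ k) i j := hp (i, j)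
  have hlim (j : Fin n) :
      ∃ L, ∀ i, Filter.Tendsto (fun m => (P ^ m) i j) Filter.atTop (nhds L) := by
    have hx (i) : (Pi.single j 1 : Fin n → ℝ) i ∈ Set.Icc (0 : ℝ) 1 := by
      by_cases h : i = j <;> simp [h]
    simpa using Matrix.exists_tendsto_pow_mulVec hP (hk p.1 p.2) hε hx
  choose w hw using hlim
  have hpos (j) : 0 < w j := by
    refine (hk p.1 p.2).trans_le (ge_of_tendsto (hw j i₀) ?_)
    filter_upwards [Filter.eventually_ge_atTop k] with m hm
    have hx (i) : (P ^ k).mulVec (Pi.single j 1) i ∈ Set.Icc ((P ^ k) p.1 p.2) 1 := by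
      simpa using ⟨hε i j, Matrix.le_one_of_mem_rowStochastic (pow_mem hP k)⟩
    simpa using (Matrix.pow_mulVec_mem_Icc_of_le hP hm hx i₀).1
  refine ⟨w, fun j => (hpos j).le, ?_, hpos, fun i j => hw j i⟩
  refine tendsto_nhds_unique (tendsto_finsetSum _ fun j _ => hw j i₀) ?_
  simp [Matrix.sum_row_of_mem_rowStochastic (pow_mem hP _)]
end

section
/- Let n be a positive natural number, let P be an n × n real row-stochastic regular matrix, and suppose the powers P^m converge entrywise to the matrix W whose rows all equal the probability vector w. Then the matrix I - P + W is invertible, so the fundamental matrix Z = (I - P + W)⁻¹ is well defined. -/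
/-- If the powers of a row-stochastic regular matrix `P` converge entrywise to the
matrix `W` with all rows equal to the probability vector `w`, then `I - P + W`
is invertible, so the fundamental matrix `Z = (I - P + W)⁻¹` is well defined. -/
theorem fundamental_matrix_exists
    (n : ℕ) (hn : 0 < n) (P : Matrix (Fin n) (Fin n) ℝ)
    (hnonneg : ∀ i j, 0 ≤ P i j) (hrow : ∀ i, ∑ j, P i j = 1)
    (hreg : ∃ k, 1 ≤ k ∧ ∀ i j, 0 < (P ^ k) i j)
    (w : Fin n → ℝ) (hwnonneg : ∀ j, 0 ≤ w j) (hwsum : ∑ j, w j = 1)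
    (W : Matrix (Fin n) (Fin n) ℝ) (hW : ∀ i j, W i j = w j)
    (hconv : ∀ i j, Filter.Tendsto (fun m => (P ^ m) i j) Filter.atTop (nhds (W i j))) :
    IsUnit (1 - P + W) := by
  have hlim : Filter.Tendsto (fun m => P ^ m) Filter.atTop (nhds W) :=
    tendsto_pi_nhds.2 fun i => tendsto_pi_nhds.2 fun j => hconv i j
  have hWP : W * P = W := by
    refine tendsto_nhds_unique (hlim.mul_const P) ?_
    simpa only [pow_succ, Function.comp_def] using hlim.comp (Filter.tendsto_add_atTop_nat 1)
  have hWW : W * W = W := by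
    ext i j
    simp only [Matrix.mul_apply, hW, ← Finset.sum_mul, hwsum, one_mul]
  rw [← Matrix.mulVec_injective_iff_isUnit, ← Matrix.coe_mulVecLin,
    injective_iff_map_eq_zero]
  intro v hv
  rw [Matrix.mulVecLin_apply] at hv
  have hWv : W.mulVec v = 0 := by
    have h := congrArg W.mulVec hv
    rwa [Matrix.mulVec_mulVec, mul_add, mul_sub, mul_one, hWP, hWW, sub_self, zero_add,
      Matrix.mulVec_zero] at h
  have hPv : P.mulVec v = v := by
    rw [Matrix.add_mulVec, Matrix.sub_mulVec, Matrix.one_mulVec, hWv, add_zero] at hv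
    exact (sub_eq_zero.1 hv).symm
  have hpow : ∀ m, (P ^ m).mulVec v = v := by
    intro m
    induction m with
    | zero => simp
    | succ m ih => rw [pow_succ, ← Matrix.mulVec_mulVec, hPv, ih]
  have hcont : Continuous fun A : Matrix (Fin n) (Fin n) ℝ => A.mulVec v := by fun_prop
  have h := (hcont.tendsto W).comp hlim
  simp only [Function.comp_def, hpow, hWv] at h
  exact tendsto_nhds_unique tendsto_const_nhds h
end

section
/- Let n be a positive natural number, let P be an n × n real row-stochastic regular matrix, let W be the entrywise limit of the powers P^m (whose rows all equal the stationary probability vector w), and let Z = (I - P + W)⁻¹ be the fundamental matrix. Then every row of Z sums to 1: for each i, ∑ j, Z i j = 1. -/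
open Filter Topology Matrix in
/-- If `P ^ m → W` with `W` idempotent, then `1 - P + W` is invertible. -/
theorem Matrix.isUnit_one_sub_add_of_tendsto_pow {ι : Type*} [Fintype ι] [DecidableEq ι]
    {P W : Matrix ι ι ℝ} (hW : W * W = W)
    (hconv : Tendsto (fun m : ℕ => P ^ m) atTop (𝓝 W)) : IsUnit (1 - P + W) := by
  have hWP : W * P = W := by
    refine tendsto_nhds_unique (f := fun m : ℕ => P ^ (m + 1)) ?_
      (hconv.comp (tendsto_add_atTop_nat 1))
    simp only [pow_succ]
    exact ((continuous_id.matrix_mul continuous_const).tendsto W).comp hconv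
  rw [← Matrix.mulVec_injective_iff_isUnit]
  refine (injective_iff_map_eq_zero (Matrix.mulVecLin (1 - P + W))).2 fun x hx => ?_
  rw [Matrix.mulVecLin_apply] at hx
  have hWx : W *ᵥ x = 0 := by
    have hmul : W * (1 - P + W) = W := by
      rw [mul_add, mul_sub, hWP, hW, mul_one, sub_self, zero_add]
    rw [← hmul, ← Matrix.mulVec_mulVec, hx, Matrix.mulVec_zero]
  have hPx : P *ᵥ x = x := by
    rw [Matrix.add_mulVec, Matrix.sub_mulVec, hWx, Matrix.one_mulVec, add_zero] at hx
    exact (sub_eq_zero.1 hx).symm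
  have hpow : ∀ m : ℕ, P ^ m *ᵥ x = x := fun m => by
    induction m with
    | zero => simp
    | succ m ih => rw [pow_succ, ← Matrix.mulVec_mulVec, hPx, ih]
  have hlim : Tendsto (fun m : ℕ => P ^ m *ᵥ x) atTop (𝓝 (W *ᵥ x)) :=
    ((continuous_id.matrix_mulVec continuous_const).tendsto W).comp hconv
  simp only [hpow] at hlim
  rw [← hWx]
  exact tendsto_nhds_unique tendsto_const_nhds hlim

/-- The rows of the fundamental matrix `Z = (I - P + W)⁻¹` each sum to `1`. -/
theorem fundamental_matrix_row_sum_one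
    (n : ℕ) (hn : 0 < n) (P : Matrix (Fin n) (Fin n) ℝ)
    (hnonneg : ∀ i j, 0 ≤ P i j) (hrow : ∀ i, ∑ j, P i j = 1)
    (hreg : ∃ k, 1 ≤ k ∧ ∀ i j, 0 < (P ^ k) i j)
    (w : Fin n → ℝ) (hwnonneg : ∀ j, 0 ≤ w j) (hwsum : ∑ j, w j = 1)
    (W : Matrix (Fin n) (Fin n) ℝ) (hW : ∀ i j, W i j = w j)
    (hconv : ∀ i j, Filter.Tendsto (fun m => (P ^ m) i j) Filter.atTop (nhds (W i j)))
    (Z : Matrix (Fin n) (Fin n) ℝ) (hZ : Z = (1 - P + W)⁻¹) :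
    ∀ i, ∑ j, Z i j = 1 := by
 
  have hWW : W * W = W := by
    ext i j
    simp [Matrix.mul_apply, hW, ← Finset.sum_mul, hwsum]
  have hunit : IsUnit (1 - P + W) :=
    Matrix.isUnit_one_sub_add_of_tendsto_pow hWW
      (tendsto_pi_nhds.2 fun i => tendsto_pi_nhds.2 fun j => hconv i j)
  have hone : (1 - P + W).mulVec (1 : Fin n → ℝ) = 1 := by
    ext i
    rw [Matrix.add_mulVec, Matrix.sub_mulVec, Matrix.one_mulVec]
    simp [Matrix.mulVec, dotProduct, hrow, hW, hwsum]
  have hZone : Z.mulVec (1 : Fin n → ℝ) = 1 := by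
    conv_lhs => rw [← hone]
    rw [Matrix.mulVec_mulVec, hZ,
      Matrix.nonsing_inv_mul _ ((Matrix.isUnit_iff_isUnit_det _).1 hunit), Matrix.one_mulVec]
  intro i
  simpa [Matrix.mulVec, dotProduct] using congrFun hZone i
end

section
/- Let n be a positive natural number, let P be an n × n real row-stochastic regular matrix, let W be the entrywise limit of the powers P^m (whose rows all equal the stationary probability vector w), and let Z = (I - P + W)⁻¹ be the fundamental matrix. Then w is a left fixed vector of Z: for every j, ∑ i, w i * Z i j = w j. Moreover W * Z = W. -/
open Filter Topology in
/-- If `P ^ m` converges to `W`, then `W` absorbs `P` on the right. -/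
theorem Matrix.mul_eq_of_tendsto_pow {ι : Type*} [Fintype ι] [DecidableEq ι]
    {P W : Matrix ι ι ℝ} (h : Tendsto (fun m : ℕ => P ^ m) atTop (𝓝 W)) : W * P = W := by
  have h₁ : Tendsto (fun m : ℕ => P ^ m * P) atTop (𝓝 (W * P)) :=
    ((continuous_id.matrix_mul continuous_const).tendsto W).comp h
  simp only [← pow_succ] at h₁
  exact tendsto_nhds_unique h₁ (h.comp (tendsto_add_atTop_nat 1))

open Filter Topology in
/-- If `P ^ m` converges to `W`, then every vector fixed by `P` is fixed by `W`. -/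
theorem Matrix.mulVec_eq_of_tendsto_pow {ι : Type*} [Fintype ι] [DecidableEq ι]
    {P W : Matrix ι ι ℝ} (h : Tendsto (fun m : ℕ => P ^ m) atTop (𝓝 W))
    {v : ι → ℝ} (hv : P.mulVec v = v) : W.mulVec v = v := by
  have hpow (m : ℕ) : (P ^ m).mulVec v = v := by
    induction m with
    | zero => simp
    | succ m ih => rw [pow_succ, ← Matrix.mulVec_mulVec, hv, ih]
  have h₁ : Tendsto (fun m : ℕ => (P ^ m).mulVec v) atTop (𝓝 (W.mulVec v)) :=
    ((continuous_id.matrix_mulVec continuous_const).tendsto W).comp h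
  simp only [hpow] at h₁
  exact tendsto_nhds_unique h₁ tendsto_const_nhds

open Filter Topology in
/-- If `P ^ m` converges to an idempotent `W`, then `1 - P + W` is invertible. -/
theorem Matrix.isUnit_det_one_sub_add_of_tendsto_pow {ι : Type*} [Fintype ι] [DecidableEq ι]
    {P W : Matrix ι ι ℝ} (h : Tendsto (fun m : ℕ => P ^ m) atTop (𝓝 W)) (hWW : W * W = W) :
    IsUnit (1 - P + W).det := by
  rw [isUnit_iff_ne_zero]
  intro hdet
  obtain ⟨v, hv, hv₀⟩ := Matrix.exists_mulVec_eq_zero_iff.mpr hdet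
  have hW : W * (1 - P + W) = W := by
    rw [mul_add, mul_sub, mul_one, Matrix.mul_eq_of_tendsto_pow h, hWW, sub_self, zero_add]
  have hWv : W.mulVec v = 0 := by
    rw [← hW, ← Matrix.mulVec_mulVec, hv₀, Matrix.mulVec_zero]
  rw [Matrix.add_mulVec, Matrix.sub_mulVec, Matrix.one_mulVec, hWv, add_zero, sub_eq_zero] at hv₀
  exact hv ((Matrix.mulVec_eq_of_tendsto_pow h hv₀.symm).symm.trans hWv)


/-- The stationary vector `w` is a left fixed vector of the fundamental matrix
`Z = (I - P + W)⁻¹`, and `W * Z = W`. -/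
theorem fundamental_matrix_left_fixed
    (n : ℕ) (hn : 0 < n) (P : Matrix (Fin n) (Fin n) ℝ)
    (hnonneg : ∀ i j, 0 ≤ P i j) (hrow : ∀ i, ∑ j, P i j = 1)
    (hreg : ∃ k, 1 ≤ k ∧ ∀ i j, 0 < (P ^ k) i j)
    (w : Fin n → ℝ) (hwnonneg : ∀ j, 0 ≤ w j) (hwsum : ∑ j, w j = 1)
    (W : Matrix (Fin n) (Fin n) ℝ) (hW : ∀ i j, W i j = w j)
    (hconv : ∀ i j, Filter.Tendsto (fun m => (P ^ m) i j) Filter.atTop (nhds (W i j)))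
    (Z : Matrix (Fin n) (Fin n) ℝ) (hZ : Z = (1 - P + W)⁻¹) :
    (∀ j, ∑ i, w i * Z i j = w j) ∧ W * Z = W := by
  have h : Filter.Tendsto (fun m : ℕ => P ^ m) Filter.atTop (nhds W) :=
    tendsto_pi_nhds.mpr fun i => tendsto_pi_nhds.mpr fun j => hconv i j
  have hWW : W * W = W := by
    ext i j
    simp only [Matrix.mul_apply, hW, ← Finset.sum_mul, hwsum, one_mul]
  have hWZ : W * Z = W := by
    have hWA : W * (1 - P + W) = W := by
      rw [mul_add, mul_sub, mul_one, Matrix.mul_eq_of_tendsto_pow h, hWW, sub_self, zero_add]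
    calc W * Z = W * (1 - P + W) * (1 - P + W)⁻¹ := by rw [hWA, hZ]
      _ = W := Matrix.mul_nonsing_inv_cancel_right _ _
        (Matrix.isUnit_det_one_sub_add_of_tendsto_pow h hWW)
  refine ⟨fun j => ?_, hWZ⟩
  have hj := congrFun (congrFun hWZ ⟨0, hn⟩) j
  simpa only [Matrix.mul_apply, hW] using hj
end
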